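/- arXiv:cs/0606034 — 8 statements merged into one kernel-verified Lean document; each statement's English description precedes it below -/
import Mathlib

section
/- For all real numbers a, b with a² + b² = 1, all real x, y, and every natural number n, the probabilists' Hermite polynomials satisfy the addition formula H_n(a·x + b·y) = Σ_{k=0}^{n} C(n,k) · a^k · b^{n−k} · H_k(x) · H_{n−k}(y), where C(n,k) is the binomial coefficient. -/
/-- The probabilists' Hermite polynomial, as a real function. -/
noncomputable def H (n : ℕ) (x : ℝ) : ℝ := Polynomial.aeval x (Polynomial.hermite n)

theorem H_hasDerivAt (n : ℕ) (x : ℝ) : HasDerivAt (H n) (x * H n x - H (n + 1) x) x := by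
  have h := Polynomial.hasDerivAt_aeval (Polynomial.hermite n) x
  have e : x * H n x - H (n + 1) x
      = Polynomial.aeval x (Polynomial.derivative (Polynomial.hermite n)) := by
    simp [H, Polynomial.hermite_succ]
  rw [e]
  exact h

theorem H_add_aux (a b : ℝ) (hab : a ^ 2 + b ^ 2 = 1) (n : ℕ) : ∀ x y : ℝ,
    H n (a * x + b * y) = ∑ p ∈ Finset.HasAntidiagonal.antidiagonal n,
      (n.choose p.1 : ℝ) * (a ^ p.1 * b ^ p.2 * H p.1 x * H p.2 y) := by
  induction n with
  | zero => intro x y; simp [H]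
  | succ n ih =>
    intro x y
    have lx : HasDerivAt (fun t : ℝ => x + a * t) a 0 := by
      simpa using ((hasDerivAt_id (0 : ℝ)).const_mul a).const_add x
    have ly : HasDerivAt (fun t : ℝ => y + b * t) b 0 := by
      simpa using ((hasDerivAt_id (0 : ℝ)).const_mul b).const_add y
    have cx : ∀ k, HasDerivAt (fun t : ℝ => H k (x + a * t)) ((x * H k x - H (k + 1) x) * a) 0 := by
      intro k
      exact HasDerivAt.comp (h₂ := H k) (0 : ℝ) (by simpa using H_hasDerivAt k x) lx
    have cy : ∀ k, HasDerivAt (fun t : ℝ => H k (y + b * t)) ((y * H k y - H (k + 1) y) * b) 0 := by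
      intro k
      exact HasDerivAt.comp (h₂ := H k) (0 : ℝ) (by simpa using H_hasDerivAt k y) ly
    have d1 : HasDerivAt (fun t : ℝ => H n (a * (x + a * t) + b * (y + b * t)))
        (((a * x + b * y) * H n (a * x + b * y) - H (n + 1) (a * x + b * y)) * (a * a + b * b)) 0 :=
      HasDerivAt.comp (h₂ := H n) (0 : ℝ) (by simpa using H_hasDerivAt n (a * x + b * y))
        ((lx.const_mul a).add (ly.const_mul b))
    have d2 : HasDerivAt (fun t : ℝ => ∑ p ∈ Finset.HasAntidiagonal.antidiagonal n,
        (n.choose p.1 : ℝ) * (a ^ p.1 * b ^ p.2 * (H p.1 (x + a * t) * H p.2 (y + b * t))))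
        (∑ p ∈ Finset.HasAntidiagonal.antidiagonal n, (n.choose p.1 : ℝ) * (a ^ p.1 * b ^ p.2 *
          ((x * H p.1 x - H (p.1 + 1) x) * a * H p.2 y +
            H p.1 x * ((y * H p.2 y - H (p.2 + 1) y) * b)))) 0 := by
      apply HasDerivAt.fun_sum
      intro p _
      have := (((cx p.1).mul (cy p.2)).const_mul (a ^ p.1 * b ^ p.2)).const_mul (n.choose p.1 : ℝ)
      simpa using this
    have e : (fun t : ℝ => H n (a * (x + a * t) + b * (y + b * t))) = _ :=
      funext fun t => ih (x + a * t) (y + b * t)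
    rw [e] at d1
    simp only [← mul_assoc] at d1 d2
    have key := d1.unique d2
    have hab' : a * a + b * b = 1 := by linarith [hab, sq a, sq b]
    rw [hab', mul_one] at key
    rw [Finset.sum_antidiagonal_choose_succ_mul
      (fun i j => a ^ i * b ^ j * H i x * H j y) n, ← Finset.sum_add_distrib]
    have : H (n + 1) (a * x + b * y) = (a * x + b * y) * H n (a * x + b * y) -
      ((a * x + b * y) * H n (a * x + b * y) - H (n + 1) (a * x + b * y)) := by ring
    rw [this, key, ih x y, Finset.mul_sum, ← Finset.sum_sub_distrib]
    apply Finset.sum_congr rfl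
    intro p hp
    have hc : n.choose p.2 = n.choose p.1 :=
      (Nat.choose_symm_of_eq_add (Finset.HasAntidiagonal.mem_antidiagonal.mp hp).symm).symm
    try rw [hc]
    ring

/-- Addition formula for the probabilists' Hermite polynomials: if `a² + b² = 1` then
`H_n (a x + b y) = ∑_{k=0}^n C(n,k) a^k b^(n-k) H_k x * H_(n-k) y`. -/
theorem hermite_addition_formula (a b : ℝ) (hab : a ^ 2 + b ^ 2 = 1) (x y : ℝ) (n : ℕ) :
    H n (a * x + b * y) =
      ∑ k ∈ Finset.range (n + 1),
        (n.choose k : ℝ) * a ^ k * b ^ (n - k) * H k x * H (n - k) y := by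
  rw [H_add_aux a b hab, Finset.Nat.sum_antidiagonal_eq_sum_range_succ_mk]
  apply Finset.sum_congr rfl
  intro k _
  ring
end

section
/- Let σ > 0 and set γ = 1/√(1+σ²). For every natural number ℓ and every real s, the expectation of H_ℓ(γ·(s+z)) when z is drawn from the centered Gaussian distribution of variance σ² equals γ^ℓ · H_ℓ(s); that is, ∫_ℝ H_ℓ(γ·(s+z)) · exp(−z²/(2σ²))/√(2πσ²) dz = γ^ℓ · H_ℓ(s). -/
open Polynomial MeasureTheory

lemma derivative_hermite_aux (n : ℕ) :
    derivative (hermite (n + 1)) = ((n : ℤ[X]) + 1) * hermite n := by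
  induction n with
  | zero => simp
  | succ k ih =>
    have h2 : derivative (derivative (hermite (k + 1)))
        = ((k : ℤ[X]) + 1) * derivative (hermite k) := by
      rw [ih, derivative_mul]; simp
    rw [hermite_succ (k + 1), derivative_sub, derivative_mul, h2, ih]
    have h3 := hermite_succ k
    rw [derivative_X]
    push_cast
    linear_combination (-((k : ℤ[X]) + 1)) * h3

lemma H_zero_aux (x : ℝ) : H 0 x = 1 := by simp [H]
lemma H_one_aux (x : ℝ) : H 1 x = x := by simp [H]
lemma H_rec_aux (n : ℕ) (x : ℝ) : H (n + 2) x = x * H (n + 1) x - (n + 1) * H n x := by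
  unfold H
  rw [hermite_succ (n + 1), derivative_hermite_aux]
  simp

/-- Gaussian weight. -/
noncomputable def wAux (σ z : ℝ) : ℝ :=
  Real.exp (-z ^ 2 / (2 * σ ^ 2)) / Real.sqrt (2 * Real.pi * σ ^ 2)

lemma wAux_deriv (σ : ℝ) (hσ : 0 < σ) (z : ℝ) :
    HasDerivAt (wAux σ) (-(z / σ ^ 2) * wAux σ z) z := by
  have h1 : HasDerivAt (fun z : ℝ => -z ^ 2 / (2 * σ ^ 2)) (-(z / σ ^ 2)) z := by
    have := ((hasDerivAt_pow 2 z).neg).div_const (2 * σ ^ 2)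
    refine this.congr_deriv ?_
    field_simp
    norm_num
  have := h1.exp.div_const (Real.sqrt (2 * Real.pi * σ ^ 2))
  refine this.congr_deriv ?_
  unfold wAux
  ring

lemma wAux_integrable (σ : ℝ) (hσ : 0 < σ) (P : ℝ[X]) :
    Integrable (fun z => P.eval z * wAux σ z) := by
  induction P using Polynomial.induction_on' with
  | add p q hp hq =>
    simp only [eval_add, add_mul]
    exact hp.add hq
  | monomial n a =>
    have hb : 0 < 1 / (2 * σ ^ 2) := by positivity
    have h := integrable_rpow_mul_exp_neg_mul_sq hb (s := (n : ℝ))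
      (lt_of_lt_of_le (by norm_num) (Nat.cast_nonneg n))
    have h2 := h.const_mul (a / Real.sqrt (2 * Real.pi * σ ^ 2))
    refine h2.congr (Filter.Eventually.of_forall fun z => ?_)
    simp only [Real.rpow_natCast, eval_monomial, wAux]
    rw [show -(1 / (2 * σ ^ 2)) * z ^ 2 = -z ^ 2 / (2 * σ ^ 2) by ring]
    ring

lemma wAux_integral (σ : ℝ) (hσ : 0 < σ) : ∫ z, wAux σ z = 1 := by
  have hv : (Real.toNNReal (σ ^ 2)) ≠ 0 := by
    rw [Ne, Real.toNNReal_eq_zero, not_le]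
    positivity
  rw [← ProbabilityTheory.integral_gaussianPDFReal_eq_one 0 hv]
  congr 1
  ext z
  simp only [ProbabilityTheory.gaussianPDFReal, wAux, Real.coe_toNNReal _ (sq_nonneg σ), sub_zero]
  ring

lemma stein_aux (σ : ℝ) (hσ : 0 < σ) (P : ℝ[X]) :
    ∫ z, z * P.eval z * wAux σ z = σ ^ 2 * ∫ z, (derivative P).eval z * wAux σ z := by
  have h := integral_mul_deriv_eq_deriv_mul_of_integrable
    (u := fun z => P.eval z) (v := wAux σ) (u' := fun z => (derivative P).eval z)
    (v' := fun z => -(z / σ ^ 2) * wAux σ z)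
    (fun x _ => P.hasDerivAt x) (fun x _ => wAux_deriv σ hσ x)
    (by
      refine (wAux_integrable σ hσ (C (-(1 / σ ^ 2)) * X * P)).congr
        (Filter.Eventually.of_forall fun z => ?_)
      simp
      ring)
    (wAux_integrable σ hσ _) (wAux_integrable σ hσ _)
  have h' : ∫ z, z * P.eval z * wAux σ z
      = -σ ^ 2 * ∫ z, P.eval z * (-(z / σ ^ 2) * wAux σ z) := by
    rw [← integral_const_mul]
    congr 1
    ext z
    field_simp
  rw [h', h]
  ring

/-- `H n (γ (s + z))` as a polynomial in `z`. -/
noncomputable def pAux (γ s : ℝ) (n : ℕ) : ℝ[X] :=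
  ((hermite n).map (Int.castRingHom ℝ)).comp (C γ * (C s + X))

lemma pAux_eval (γ s : ℝ) (n : ℕ) (z : ℝ) : (pAux γ s n).eval z = H n (γ * (s + z)) := by
  simp [pAux, H, eval_comp, aeval_def, eval_map]

lemma pAux_deriv (γ s : ℝ) (n : ℕ) :
    derivative (pAux γ s (n + 1)) = C (γ * (n + 1)) * pAux γ s n := by
  unfold pAux
  rw [derivative_comp, derivative_map, derivative_hermite_aux]
  simp
  ring

/-- For `γ = 1/√(1+σ²)` (the Wiener gain of the SAWGN attack), the Gaussian expectation of
`H_ℓ(γ(s+z))` for `z ∼ N(0,σ²)` is `γ^ℓ H_ℓ(s)`. -/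
theorem hermite_gaussian_smoothing (σ : ℝ) (hσ : 0 < σ) (γ : ℝ)
    (hγ : γ = 1 / Real.sqrt (1 + σ ^ 2)) (ℓ : ℕ) (s : ℝ) :
    (∫ z : ℝ, H ℓ (γ * (s + z)) *
        (Real.exp (-z ^ 2 / (2 * σ ^ 2)) / Real.sqrt (2 * Real.pi * σ ^ 2))) =
      γ ^ ℓ * H ℓ s := by
  have hg : γ ^ 2 * (1 + σ ^ 2) = 1 := by
    rw [hγ, div_pow, Real.sq_sqrt (by positivity)]
    field_simp
  change ∫ z : ℝ, H ℓ (γ * (s + z)) * wAux σ z = _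
  have hI : ∀ n, Integrable (fun z => H n (γ * (s + z)) * wAux σ z) := fun n => by
    simpa only [pAux_eval] using wAux_integrable σ hσ (pAux γ s n)
  have hzI : ∀ n, Integrable (fun z => z * H n (γ * (s + z)) * wAux σ z) := fun n => by
    refine (wAux_integrable σ hσ (X * pAux γ s n)).congr
      (Filter.Eventually.of_forall fun z => ?_)
    simp only []
    rw [eval_mul, eval_X, pAux_eval]
  have hst : ∀ n, ∫ z, z * H (n + 1) (γ * (s + z)) * wAux σ z
      = σ ^ 2 * (γ * (n + 1) * ∫ z, H n (γ * (s + z)) * wAux σ z) := fun n => by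
    have := stein_aux σ hσ (pAux γ s (n + 1))
    simp only [pAux_deriv, pAux_eval, eval_mul, eval_C] at this
    rw [this, ← integral_const_mul (γ * (n + 1))]
    simp only [mul_assoc]
  induction ℓ using Nat.twoStepInduction with
  | zero => simp [H_zero_aux, wAux_integral σ hσ]
  | one =>
    have h1 := stein_aux σ hσ 1
    have hw : Integrable (wAux σ) := by simpa using wAux_integrable σ hσ 1
    have hzw : Integrable (fun z => z * wAux σ z) := by simpa using wAux_integrable σ hσ X
    simp at h1
    have : ∀ z, H 1 (γ * (s + z)) * wAux σ z = γ * s * wAux σ z + γ * (z * wAux σ z) := by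
      intro z; rw [H_one_aux]; ring
    simp only [this]
    rw [integral_add (hw.const_mul _) (hzw.const_mul _), integral_const_mul, integral_const_mul,
      h1, wAux_integral σ hσ, H_one_aux]
    ring
  | more n ih0 ih1 =>
    have : ∀ z, H (n + 2) (γ * (s + z)) * wAux σ z
        = γ * s * (H (n + 1) (γ * (s + z)) * wAux σ z)
          + γ * (z * H (n + 1) (γ * (s + z)) * wAux σ z)
          - (n + 1) * (H n (γ * (s + z)) * wAux σ z) := by
      intro z; rw [H_rec_aux]; ring
    simp only [this]
    have hA : Integrable (fun z => γ * s * (H (n + 1) (γ * (s + z)) * wAux σ z)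
          + γ * (z * H (n + 1) (γ * (s + z)) * wAux σ z)) :=
      ((hI _).const_mul _).add ((hzI _).const_mul _)
    rw [integral_sub hA ((hI _).const_mul _),
      integral_add ((hI _).const_mul _) ((hzI _).const_mul _), integral_const_mul,
      integral_const_mul, integral_const_mul, hst, ih0, ih1, H_rec_aux]
    linear_combination (n + 1) * γ ^ n * H n s * hg
end

section
/- For every natural number k and every real x, the square of the probabilists' Hermite polynomial expands as H_k(x)² = Σ_{ℓ=0}^{k} C(k,ℓ)² · ℓ! · H_{2(k−ℓ)}(x), where C(k,ℓ) is the binomial coefficient. -/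
theorem aux_deriv (n : ℕ) : Polynomial.derivative (Polynomial.hermite (n + 1)) =
    ((n : Polynomial ℤ) + 1) * Polynomial.hermite n := by
  induction n with
  | zero => simp
  | succ k ih =>
    rw [Polynomial.hermite_succ (k + 1), Polynomial.derivative_sub, Polynomial.derivative_mul, ih,
      Polynomial.derivative_mul]
    have h := Polynomial.hermite_succ k
    simp only [Polynomial.derivative_X, Polynomial.derivative_add, Polynomial.derivative_natCast,
      Polynomial.derivative_one]
    push_cast
    rw [h]
    ring

theorem aux_rec (n : ℕ) (x : ℝ) : H (n + 2) x = x * H (n + 1) x - ((n : ℝ) + 1) * H n x := by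
  unfold H
  rw [Polynomial.hermite_succ (n + 1), aux_deriv]
  simp

theorem aux_coef (m n l : ℕ) :
    ((m + 2).choose (l + 1) : ℝ) * (n.choose (l + 1) : ℝ) * ((l + 1).factorial : ℝ) =
      ((m + 1).choose (l + 1) : ℝ) * ((n + 1).choose (l + 1) : ℝ) * ((l + 1).factorial : ℝ)
      + n * (((m + 1).choose l : ℝ) * ((n - 1).choose l : ℝ) * (l.factorial : ℝ))
      - (m + 1) * ((m.choose l : ℝ) * (n.choose l : ℝ) * (l.factorial : ℝ)) := by
  have h1 : (n : ℝ) * ((n - 1).choose l : ℝ) = (n.choose (l + 1) : ℝ) * (l + 1) := by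
    cases n with
    | zero => simp
    | succ k => exact_mod_cast Nat.add_one_mul_choose_eq k l
  have h2 : ((m : ℝ) + 1) * (m.choose l : ℝ) = ((m + 1).choose (l + 1) : ℝ) * (l + 1) := by
    exact_mod_cast Nat.add_one_mul_choose_eq m l
  have h3 : ((m + 2).choose (l + 1) : ℝ) = ((m + 1).choose l : ℝ) + (m + 1).choose (l + 1) := by
    exact_mod_cast Nat.choose_succ_succ (m + 1) l
  have h4 : ((n + 1).choose (l + 1) : ℝ) = (n.choose l : ℝ) + n.choose (l + 1) := by
    exact_mod_cast Nat.choose_succ_succ n l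
  have h5 : ((l + 1).factorial : ℝ) = (l + 1) * (l.factorial : ℝ) := by
    exact_mod_cast Nat.factorial_succ l
  rw [h3, h4, h5]
  linear_combination (-((m + 1).choose l : ℝ) * (l.factorial : ℝ)) * h1
    + ((n.choose l : ℝ) * (l.factorial : ℝ)) * h2

theorem aux_x (n : ℕ) (x : ℝ) : x * H n x = H (n + 1) x + n * H (n - 1) x := by
  cases n with
  | zero => simp [H]
  | succ k => rw [aux_rec]; push_cast; simp

theorem aux_prod (x : ℝ) (m : ℕ) : ∀ n N : ℕ, m < N → H m x * H n x =
    ∑ l ∈ Finset.range N, (m.choose l : ℝ) * (n.choose l : ℝ) * (l.factorial : ℝ)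
      * H (m + n - 2 * l) x := by
  induction m using Nat.strong_induction_on with
  | _ m ih =>
  match m, ih with
  | 0, _ =>
    intro n N hN
    obtain ⟨N, rfl⟩ : ∃ k, N = k + 1 := ⟨N - 1, by omega⟩
    rw [Finset.sum_range_succ']
    simp [H]
  | 1, _ =>
    intro n N hN
    obtain ⟨N, rfl⟩ : ∃ k, N = k + 2 := ⟨N - 2, by omega⟩
    rw [Finset.sum_range_succ', Finset.sum_range_succ']
    have h1 : H 1 x = x := by simp [H]
    have h : 1 + n - 2 = n - 1 := by omega
    have h' : ∀ k, Nat.choose 1 (k + 1 + 1) = 0 := fun k => Nat.choose_eq_zero_of_lt (by omega)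
    rw [h1, aux_x]
    simp only [h']
    simp [h, add_comm]
  | m + 2, ih =>
    intro n N hN
    obtain ⟨N, rfl⟩ : ∃ k, N = k + 1 := ⟨N - 1, by omega⟩
    have e1 := ih (m + 1) (by omega) (n + 1) (N + 1) (by omega)
    have e2 := ih (m + 1) (by omega) (n - 1) N (by omega)
    have e3 := ih m (by omega) n N (by omega)
    have key : H (m + 2) x * H n x = H (m + 1) x * H (n + 1) x
        + n * (H (m + 1) x * H (n - 1) x) - (m + 1) * (H m x * H n x) := by
      rw [aux_rec]
      linear_combination H (m + 1) x * aux_x n x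
    rw [key, e1, e2, e3, Finset.sum_range_succ', Finset.sum_range_succ' _ N, Finset.mul_sum,
      Finset.mul_sum]
    have e4 : m + 1 + (n + 1) = m + 2 + n := by omega
    have hs : ∀ l, ((m + 2).choose (l + 1) : ℝ) * (n.choose (l + 1) : ℝ)
          * ((l + 1).factorial : ℝ) * H (m + 2 + n - 2 * (l + 1)) x =
        ((m + 1).choose (l + 1) : ℝ) * ((n + 1).choose (l + 1) : ℝ) * ((l + 1).factorial : ℝ)
          * H (m + 1 + (n + 1) - 2 * (l + 1)) x
        + n * (((m + 1).choose l : ℝ) * ((n - 1).choose l : ℝ) * (l.factorial : ℝ)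
          * H (m + 1 + (n - 1) - 2 * l) x)
        - (m + 1) * ((m.choose l : ℝ) * (n.choose l : ℝ) * (l.factorial : ℝ)
          * H (m + n - 2 * l) x) := by
      intro l
      have a1 : m + 1 + (n + 1) - 2 * (l + 1) = m + n - 2 * l := by omega
      have a2 : m + 2 + n - 2 * (l + 1) = m + n - 2 * l := by omega
      rw [aux_coef, a1, a2]
      rcases Nat.eq_zero_or_pos n with h | h
      · subst h
        push_cast
        ring
      · have a3 : m + 1 + (n - 1) - 2 * l = m + n - 2 * l := by omega
        rw [a3]
        ring
    rw [Finset.sum_congr rfl (fun l _ => hs l), Finset.sum_sub_distrib, Finset.sum_add_distrib, e4]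
    simp only [Nat.choose_zero_right]
    ring

/-- The square of a probabilists' Hermite polynomial expands as
`H_k(x)² = ∑_{ℓ=0}^k C(k,ℓ)² ℓ! H_{2(k-ℓ)}(x)`. -/
theorem hermite_sq_expansion (k : ℕ) (x : ℝ) :
    H k x ^ 2 =
      ∑ ℓ ∈ Finset.range (k + 1),
        (k.choose ℓ : ℝ) ^ 2 * (ℓ.factorial : ℝ) * H (2 * (k - ℓ)) x := by
  rw [sq, aux_prod x k k (k + 1) (by omega)]
  refine Finset.sum_congr rfl fun l _ => ?_
  have h : k + k - 2 * l = 2 * (k - l) := by omega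
  rw [h, sq]
end

section
/- Let p and m be positive integers, n = m·p, σ > 0, and define the JANIS detection function t : ℝⁿ → ℝ by t(r) = √(p/n) · Σ_{i=1}^{m} Π_{j=1}^{p} (r_{(i−1)p+j}/σ). Then for every r ∈ ℝⁿ: (i) ⟨r, ∇t(r)⟩ = p·t(r); (ii) the Laplacian Δt(r) = Σ_{i=1}^{n} ∂²t/∂r_i²(r) = 0; and consequently (iii) with η = p/σ², the fundamental equation η·t(r) − ⟨r, ∇t(r)⟩/σ² + Δt(r) = 0 holds for all r ∈ ℝⁿ. -/
theorem janis_aux_line {n : ℕ} (g : (Fin n → ℝ) → ℝ) (r v : Fin n → ℝ) (d : ℝ)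
    (hg : DifferentiableAt ℝ g r) (h : ∀ s : ℝ, g (r + s • v) = g r + s * d) :
    fderiv ℝ g r v = d := by
  rw [← hg.lineDeriv_eq_fderiv]
  have h2 : HasDerivAt (fun s : ℝ => g r + s * d) d 0 := by
    simpa using ((hasDerivAt_id (0 : ℝ)).mul_const d).const_add (g r)
  unfold lineDeriv
  simp_rw [h]
  exact h2.deriv

theorem janis_aux_const {p m : ℕ} (σ s : ℝ) (r : Fin (m * p) → ℝ) (a : Fin m) (b : Fin p) :
    ∏ j ∈ Finset.univ.erase b,
      (r + s • (Pi.single (finProdFinEquiv (a, b)) 1 : Fin (m * p) → ℝ))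
        (finProdFinEquiv (a, j)) / σ
      = ∏ j ∈ Finset.univ.erase b, r (finProdFinEquiv (a, j)) / σ := by
  refine Finset.prod_congr rfl fun j hj => ?_
  have hne : j ≠ b := Finset.ne_of_mem_erase hj
  simp [Pi.single_apply, hne]

theorem janis_aux_grad {p m : ℕ} (σ c : ℝ) (r : Fin (m * p) → ℝ) (a : Fin m) (b : Fin p) :
    fderiv ℝ (fun r : Fin (m * p) → ℝ =>
      c * ∑ i : Fin m, ∏ j : Fin p, r (finProdFinEquiv (i, j)) / σ) r
      (Pi.single (finProdFinEquiv (a, b)) 1)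
      = c * ((∏ j ∈ Finset.univ.erase b, r (finProdFinEquiv (a, j)) / σ) / σ) := by
  apply janis_aux_line
  · fun_prop
  intro s
  have key : ∀ i : Fin m, ∏ j : Fin p,
      (r + s • (Pi.single (finProdFinEquiv (a, b)) 1 : Fin (m * p) → ℝ))
        (finProdFinEquiv (i, j)) / σ
      = (∏ j : Fin p, r (finProdFinEquiv (i, j)) / σ) + if i = a then
        s * ((∏ j ∈ Finset.univ.erase b, r (finProdFinEquiv (a, j)) / σ) / σ) else 0 := by
    intro i
    by_cases hi : i = a
    · subst hi
      rw [← Finset.mul_prod_erase _ _ (Finset.mem_univ b), janis_aux_const,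
        ← Finset.mul_prod_erase Finset.univ (fun j => r (finProdFinEquiv (i, j)) / σ)
          (Finset.mem_univ b)]
      simp
      ring
    · simp [Pi.single_apply, hi]
  simp_rw [key]
  rw [Finset.sum_add_distrib]
  simp
  ring

/-- The JANIS detection function `t(r) = √(p/n) ∑_{i=1}^{m} ∏_{j=1}^{p} r_{(i-1)p+j}/σ`
on `ℝⁿ` with `n = m p` satisfies `⟨r, ∇t(r)⟩ = p t(r)`, `Δt(r) = 0`, and hence the
fundamental equation `η t(r) - ⟨r, ∇t(r)⟩/σ² + Δt(r) = 0` with `η = p/σ²`. -/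
theorem janis_fundamental_solution (p m : ℕ) (hp : 0 < p) (hm : 0 < m)
    (σ : ℝ) (hσ : 0 < σ) (t : (Fin (m * p) → ℝ) → ℝ)
    (ht : t = fun r => Real.sqrt ((p : ℝ) / (m * p)) *
      ∑ i : Fin m, ∏ j : Fin p, r (finProdFinEquiv (i, j)) / σ) :
    ∀ r : Fin (m * p) → ℝ,
      (∑ i, r i * fderiv ℝ t r (Pi.single i 1)) = p * t r ∧
      (∑ i, fderiv ℝ (fun y => fderiv ℝ t y (Pi.single i 1)) r (Pi.single i 1)) = 0 ∧
      ((p : ℝ) / σ ^ 2) * t r - (∑ i, r i * fderiv ℝ t r (Pi.single i 1)) / σ ^ 2 +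
        (∑ i, fderiv ℝ (fun y => fderiv ℝ t y (Pi.single i 1)) r (Pi.single i 1)) = 0 := by
  intro r
  subst ht
  set c := Real.sqrt ((p : ℝ) / (m * p))
  have h1 : (∑ i, r i * fderiv ℝ (fun r : Fin (m * p) → ℝ =>
      c * ∑ i : Fin m, ∏ j : Fin p, r (finProdFinEquiv (i, j)) / σ) r (Pi.single i 1))
      = p * (c * ∑ i : Fin m, ∏ j : Fin p, r (finProdFinEquiv (i, j)) / σ) := by
    rw [← finProdFinEquiv.sum_comp, Fintype.sum_prod_type]
    simp_rw [janis_aux_grad]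
    have : ∀ (a : Fin m) (b : Fin p), r (finProdFinEquiv (a, b)) *
        (c * ((∏ j ∈ Finset.univ.erase b, r (finProdFinEquiv (a, j)) / σ) / σ))
        = c * ∏ j : Fin p, r (finProdFinEquiv (a, j)) / σ := by
      intro a b
      rw [← Finset.mul_prod_erase Finset.univ (fun j => r (finProdFinEquiv (a, j)) / σ)
          (Finset.mem_univ b)]
      ring
    simp_rw [this]
    simp only [Finset.sum_const, Finset.card_univ, Fintype.card_fin, nsmul_eq_mul,
      ← Finset.mul_sum]
  have h2 : (∑ i, fderiv ℝ (fun y => fderiv ℝ (fun r : Fin (m * p) → ℝ =>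
      c * ∑ i : Fin m, ∏ j : Fin p, r (finProdFinEquiv (i, j)) / σ) y (Pi.single i 1)) r
      (Pi.single i 1)) = 0 := by
    rw [← finProdFinEquiv.sum_comp]
    refine Finset.sum_eq_zero fun x _ => ?_
    obtain ⟨a, b⟩ := x
    simp_rw [janis_aux_grad]
    apply janis_aux_line
    · fun_prop
    intro s
    rw [janis_aux_const]
    ring
  refine ⟨h1, h2, ?_⟩
  rw [h1, h2]
  ring
end

section
/- Let p ≥ 2 be an integer, σ > 0, and define t : ℝᵖ → ℝ by t(r) = ((p−1)·r_p² − Σ_{i=1}^{p−1} r_i²) / (σ²·√(2p(p−1))). Then for every r ∈ ℝᵖ: ⟨r, ∇t(r)⟩ = 2·t(r), Δt(r) = 0, and with η = 2/σ² the fundamental equation η·t(r) − ⟨r, ∇t(r)⟩/σ² + Δt(r) = 0 holds. The acceptance region t(r) = τ > 0 is hence a p-dimensional two-sheet hyperboloid. -/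
lemma diag_quad_fderiv {p : ℕ} (c : Fin p → ℝ) (y : Fin p → ℝ) (i : Fin p) :
    fderiv ℝ (fun r : Fin p → ℝ => ∑ j, c j * r j ^ 2) y (Pi.single i 1) = 2 * c i * y i := by
  have h : HasFDerivAt (fun r : Fin p → ℝ => ∑ j, c j * r j ^ 2)
      (∑ j, (2 * c j * y j) • (ContinuousLinearMap.proj j : (Fin p → ℝ) →L[ℝ] ℝ)) y := by
    apply HasFDerivAt.fun_sum
    intro j _
    have h1 : HasFDerivAt (fun r : Fin p → ℝ => r j)
      (ContinuousLinearMap.proj j : (Fin p → ℝ) →L[ℝ] ℝ) y := hasFDerivAt_apply j y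
    have h2 := (h1.pow 2).const_mul (c j)
    refine h2.congr_fderiv ?_
    refine ContinuousLinearMap.ext fun v => ?_
    change c j * ((2 • y j ^ (2 - 1)) * v j) = (2 * c j * y j) * v j
    simp
    ring
  rw [h.fderiv]
  simp [Pi.single_apply]

lemma diag_lin_fderiv {p : ℕ} (a : ℝ) (y : Fin p → ℝ) (i : Fin p) :
    fderiv ℝ (fun r : Fin p → ℝ => a * r i) y (Pi.single i 1) = a := by
  have h1 : HasFDerivAt (fun r : Fin p → ℝ => r i)
      (ContinuousLinearMap.proj i : (Fin p → ℝ) →L[ℝ] ℝ) y := hasFDerivAt_apply i y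
  rw [(h1.const_mul a).fderiv]
  simp

/-- The two-sheet hyperboloid detection function
`t(r) = ((p-1) r_p² - ∑_{i=1}^{p-1} r_i²)/(σ² √(2p(p-1)))` satisfies
`⟨r, ∇t(r)⟩ = 2 t(r)`, `Δt(r) = 0`, and hence the fundamental equation
`η t(r) - ⟨r, ∇t(r)⟩/σ² + Δt(r) = 0` with `η = 2/σ²`. -/
theorem hyperboloid_fundamental_solution (p : ℕ) (hp : 2 ≤ p) (σ : ℝ) (hσ : 0 < σ)
    (t : (Fin p → ℝ) → ℝ)
    (ht : t = fun r =>
      (((p : ℝ) - 1) * r ⟨p - 1, by omega⟩ ^ 2 -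
          ∑ i : Fin (p - 1), r (Fin.castLE (Nat.sub_le p 1) i) ^ 2) /
        (σ ^ 2 * Real.sqrt (2 * p * (p - 1)))) :
    ∀ r : Fin p → ℝ,
      (∑ i, r i * fderiv ℝ t r (Pi.single i 1)) = 2 * t r ∧
      (∑ i, fderiv ℝ (fun y => fderiv ℝ t y (Pi.single i 1)) r (Pi.single i 1)) = 0 ∧
      (2 / σ ^ 2) * t r - (∑ i, r i * fderiv ℝ t r (Pi.single i 1)) / σ ^ 2 +
        (∑ i, fderiv ℝ (fun y => fderiv ℝ t y (Pi.single i 1)) r (Pi.single i 1)) = 0 := by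
  obtain ⟨n, rfl⟩ : ∃ n, p = n + 1 := ⟨p - 1, by omega⟩
  set D : ℝ := σ ^ 2 * Real.sqrt (2 * ((n + 1 : ℕ) : ℝ) * (((n + 1 : ℕ) : ℝ) - 1)) with hD
  obtain ⟨c, hc⟩ : ∃ c : Fin (n + 1) → ℝ,
      c = Fin.snoc (α := fun _ => ℝ) (fun _ : Fin n => -1 / D) ((n : ℝ) / D) := ⟨_, rfl⟩
  have hcl : c (Fin.last n) = n / D := by simp [hc]
  have hcc : ∀ i : Fin n, c i.castSucc = -1 / D := by intro i; simp [hc]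
  have ht' : t = fun r => ∑ j, c j * r j ^ 2 := by
    rw [ht]
    funext r
    rw [Fin.sum_univ_castSucc]
    simp only [hcl, hcc, ← Finset.mul_sum]
    change ((((n + 1 : ℕ) : ℝ) - 1) * r (Fin.last n) ^ 2 -
      ∑ i : Fin n, r i.castSucc ^ 2) / D = _
    push_cast
    ring
  clear ht
  have h0 : ∑ i, c i = 0 := by
    rw [Fin.sum_univ_castSucc]
    simp only [hcl, hcc, Finset.sum_const, Finset.card_univ, Fintype.card_fin, nsmul_eq_mul]
    ring
  intro r
  have h1 : (∑ i, r i * fderiv ℝ t r (Pi.single i 1)) = 2 * t r := by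
    rw [ht']
    simp only [diag_quad_fderiv, Finset.mul_sum]
    exact Finset.sum_congr rfl fun i _ => by ring
  have h2 : (∑ i, fderiv ℝ (fun y => fderiv ℝ t y (Pi.single i 1)) r (Pi.single i 1)) = 0 := by
    rw [ht']
    simp only [diag_quad_fderiv, diag_lin_fderiv]
    rw [← Finset.mul_sum, h0, mul_zero]
  refine ⟨h1, h2, ?_⟩
  rw [h1, h2]
  ring
end

section
/- Let p ≥ 1 be an integer and η > 0, and define t : ℝᵖ → ℝ by t(r) = cos(√η·‖r‖). Then for every r ∈ ℝᵖ with r ≠ 0, the identity η·t(r) + ⟨s(r), ∇t(r)⟩ + Δt(r) = 0 holds, where s(r) = (1−p)·r/‖r‖² is the score function ∇f(r)/f(r) of the isotropic density f(r) proportional to ‖r‖^{1−p}. -/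
lemma shf_norm {p : ℕ} (r : EuclideanSpace ℝ (Fin p)) (hr : r ≠ 0) :
    HasFDerivAt (fun y : EuclideanSpace ℝ (Fin p) => ‖y‖) (‖r‖⁻¹ • innerSL ℝ r) r := by
  have hn : ‖r‖ ≠ 0 := norm_ne_zero_iff.mpr hr
  have h1 := (hasStrictFDerivAt_norm_sq r).hasFDerivAt.sqrt (pow_ne_zero 2 hn)
  simp only [Real.sqrt_sq (norm_nonneg _)] at h1
  have e : (1 / (2 * ‖r‖)) • 2 • innerSL ℝ r = ‖r‖⁻¹ • innerSL ℝ r := by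
    rw [← Nat.cast_smul_eq_nsmul ℝ, smul_smul]
    congr 1
    push_cast
    field_simp
  rw [← e]
  exact h1

lemma shf_coord {p : ℕ} (r : EuclideanSpace ℝ (Fin p)) (i : Fin p) :
    innerSL ℝ r (EuclideanSpace.single i 1) = r i := by
  simp [EuclideanSpace.inner_single_right]

lemma shf_first {p : ℕ} (a : ℝ) (r : EuclideanSpace ℝ (Fin p)) (hr : r ≠ 0) (i : Fin p) :
    fderiv ℝ (fun y : EuclideanSpace ℝ (Fin p) => Real.cos (a * ‖y‖)) r
      (EuclideanSpace.single i 1) = -Real.sin (a * ‖r‖) * (a * (‖r‖⁻¹ * r i)) := by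
  rw [((shf_norm r hr).const_mul a).cos.fderiv]
  have := shf_coord r i
  simp only [_root_.smul_apply, smul_eq_mul, this]

lemma shf_second {p : ℕ} (a : ℝ) (r : EuclideanSpace ℝ (Fin p)) (hr : r ≠ 0) (i : Fin p) :
    fderiv ℝ (fun y => fderiv ℝ (fun y : EuclideanSpace ℝ (Fin p) => Real.cos (a * ‖y‖)) y
      (EuclideanSpace.single i 1)) r (EuclideanSpace.single i 1)
      = -(a * Real.sin (a * ‖r‖) * ‖r‖⁻¹) +
        (a * Real.sin (a * ‖r‖) * ‖r‖⁻¹ ^ 3 - a ^ 2 * Real.cos (a * ‖r‖) * ‖r‖⁻¹ ^ 2)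
          * (r i) ^ 2 := by
  have hn : ‖r‖ ≠ 0 := norm_ne_zero_iff.mpr hr
  have he : (fun y => fderiv ℝ (fun y : EuclideanSpace ℝ (Fin p) => Real.cos (a * ‖y‖)) y
      (EuclideanSpace.single i 1)) =ᶠ[nhds r]
      (fun y => -Real.sin (a * ‖y‖) * (a * (‖y‖⁻¹ * y i))) := by
    filter_upwards [isOpen_ne.mem_nhds hr] with y hy
    exact shf_first a y hy i
  rw [he.fderiv_eq]
  have hc : HasFDerivAt (fun y : EuclideanSpace ℝ (Fin p) => y i)
      (EuclideanSpace.proj i : EuclideanSpace ℝ (Fin p) →L[ℝ] ℝ) r :=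
    (EuclideanSpace.proj i : EuclideanSpace ℝ (Fin p) →L[ℝ] ℝ).hasFDerivAt
  have hinv := (hasDerivAt_inv hn).comp_hasFDerivAt r (shf_norm r hr)
  have h := ((shf_norm r hr).const_mul a).sin.neg.mul ((hinv.mul hc).const_mul a)
  have h' := h.fderiv
  refine (congrArg (fun L => L (EuclideanSpace.single i 1)) h').trans ?_
  have := shf_coord r i
  have hp1 : (EuclideanSpace.proj i : EuclideanSpace ℝ (Fin p) →L[ℝ] ℝ)
      (EuclideanSpace.single i 1) = 1 := by simp
  simp only [_root_.smul_apply, _root_.add_apply,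
    _root_.neg_apply, smul_eq_mul, this, Function.comp, hp1, Pi.neg_apply, Pi.mul_apply]
  field_simp
  ring

/-- The sphere-hardening detection function `t(r) = cos(√η ‖r‖)` satisfies the fundamental
equation `η t(r) + ⟨s(r), ∇t(r)⟩ + Δt(r) = 0` away from the origin, where
`s(r) = (1-p) r/‖r‖²` is the score of the isotropic density proportional to `‖r‖^{1-p}`. -/
theorem sphere_hardening_fundamental_solution (p : ℕ) (hp : 1 ≤ p) (η : ℝ) (hη : 0 < η)
    (t : EuclideanSpace ℝ (Fin p) → ℝ)
    (ht : t = fun r => Real.cos (Real.sqrt η * ‖r‖)) :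
    ∀ r : EuclideanSpace ℝ (Fin p), r ≠ 0 →
      η * t r +
        (∑ i, ((1 - (p : ℝ)) * r i / ‖r‖ ^ 2) *
          fderiv ℝ t r (EuclideanSpace.single i 1)) +
        (∑ i, fderiv ℝ (fun y => fderiv ℝ t y (EuclideanSpace.single i 1)) r
          (EuclideanSpace.single i 1)) = 0 := by
  intro r hr
  subst ht
  have hn : ‖r‖ ≠ 0 := norm_ne_zero_iff.mpr hr
  have hs : ∑ i, (r i) ^ 2 = ‖r‖ ^ 2 := (EuclideanSpace.real_norm_sq_eq r).symm
  have ha : Real.sqrt η ^ 2 = η := Real.sq_sqrt hη.le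
  simp only [shf_first _ r hr, shf_second _ r hr]
  have h1 : ∀ i, ((1 - (p : ℝ)) * r i / ‖r‖ ^ 2) *
      (-Real.sin (√η * ‖r‖) * (√η * (‖r‖⁻¹ * r i))) =
      (-(1 - (p : ℝ)) * Real.sin (√η * ‖r‖) * √η * ‖r‖⁻¹ ^ 3) * (r i) ^ 2 := by
    intro i
    field_simp
  simp only [h1, Finset.sum_add_distrib, ← Finset.mul_sum, hs, Finset.sum_const,
    Finset.card_univ, Fintype.card_fin, nsmul_eq_mul, ha]
  field_simp
  ring
end

section
/- Let n ≥ 1 be an integer, λ ∈ ℝⁿ a nonzero vector, η* > 0, f : ℝ → ℝ a function, t* : ℝ → ℝ a twice differentiable function, and p : ℝⁿ → ℝ a positive differentiable function. Assume (i) η*·t*(x) + f(x)·t*'(x) + t*''(x) = 0 for all real x, and (ii) ⟨∇p(r), λ⟩ = ‖λ‖²·p(r)·f(⟨r, λ⟩) for all r ∈ ℝⁿ. Then the projected function t(r) = t*(⟨r, λ⟩) satisfies η*·‖λ‖²·t(r) + ⟨∇p(r)/p(r), ∇t(r)⟩ + Δt(r) = 0 for all r ∈ ℝⁿ; that is, t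 is a fundamental solution with efficiency per element η = η*·‖λ‖². -/
theorem proj_fderiv_aux (n : ℕ) (lam : Fin n → ℝ) (g : ℝ → ℝ) (hg : Differentiable ℝ g)
    (c : ℝ) (r : Fin n → ℝ) (i : Fin n) :
    fderiv ℝ (fun y : Fin n → ℝ => g (∑ j, y j * lam j) * c) r (Pi.single i 1) =
      deriv g (∑ j, r j * lam j) * lam i * c := by
  let L : (Fin n → ℝ) →L[ℝ] ℝ :=
    ∑ j, lam j • (ContinuousLinearMap.proj j : (Fin n → ℝ) →L[ℝ] ℝ)
  have hL : ∀ y : Fin n → ℝ, L y = ∑ j, y j * lam j := by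
    intro y
    simp [L, ContinuousLinearMap.sum_apply, mul_comm]
  have hLi : L (Pi.single i 1) = lam i := by
    rw [hL]
    simp [Pi.single_apply]
  have h1 : HasFDerivAt (fun y : Fin n → ℝ => g (L y) * c)
      (c • (deriv g (L r) • L)) r :=
    ((hg (L r)).hasDerivAt.comp_hasFDerivAt r L.hasFDerivAt).mul_const c
  simp only [hL] at h1
  rw [h1.fderiv]
  simp only [ContinuousLinearMap.smul_apply, smul_eq_mul, hLi]
  ring

/-- Sparsity (time-sharing) construction: if `t*` solves the scalar fundamental equation
`η* t* + f t*' + t*'' = 0` and the host density `p` satisfies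
`⟨∇p(r), λ⟩ = ‖λ‖² p(r) f(⟨r, λ⟩)`, then the projected function `t(r) = t*(⟨r, λ⟩)`
solves the fundamental equation in `ℝⁿ` with efficiency `η = η* ‖λ‖²`. -/
theorem sparsity_fundamental_solution (n : ℕ) (hn : 1 ≤ n) (lam : Fin n → ℝ)
    (hlam : lam ≠ 0) (ηs : ℝ) (hηs : 0 < ηs) (f : ℝ → ℝ) (tstar : ℝ → ℝ)
    (htd : Differentiable ℝ tstar) (htd2 : Differentiable ℝ (deriv tstar))
    (p : (Fin n → ℝ) → ℝ) (hppos : ∀ r, 0 < p r) (hpd : Differentiable ℝ p)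
    (hode : ∀ x : ℝ, ηs * tstar x + f x * deriv tstar x + deriv (deriv tstar) x = 0)
    (hscore : ∀ r : Fin n → ℝ,
      (∑ i, fderiv ℝ p r (Pi.single i 1) * lam i) =
        (∑ i, lam i ^ 2) * p r * f (∑ i, r i * lam i))
    (t : (Fin n → ℝ) → ℝ) (htdef : t = fun r => tstar (∑ i, r i * lam i)) :
    ∀ r : Fin n → ℝ,
      ηs * (∑ i, lam i ^ 2) * t r +
        (∑ i, (fderiv ℝ p r (Pi.single i 1) / p r) * fderiv ℝ t r (Pi.single i 1)) +
        (∑ i, fderiv ℝ (fun y => fderiv ℝ t y (Pi.single i 1)) r (Pi.single i 1)) = 0 := by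
  intro r
  subst htdef
  have h1 : ∀ (y : Fin n → ℝ) (i : Fin n),
      fderiv ℝ (fun r : Fin n → ℝ => tstar (∑ j, r j * lam j)) y (Pi.single i 1) =
        deriv tstar (∑ j, y j * lam j) * lam i := by
    intro y i
    simpa using proj_fderiv_aux n lam tstar htd 1 y i
  simp only [h1, proj_fderiv_aux n lam (deriv tstar) htd2]
  have hp := (hppos r).ne'
  have h2 : (∑ i, (fderiv ℝ p r (Pi.single i 1) / p r) *
      (deriv tstar (∑ j, r j * lam j) * lam i)) =
      (∑ i, lam i ^ 2) * f (∑ i, r i * lam i) * deriv tstar (∑ j, r j * lam j) := by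
    have : ∀ i, (fderiv ℝ p r (Pi.single i 1) / p r) *
      (deriv tstar (∑ j, r j * lam j) * lam i) =
      (fderiv ℝ p r (Pi.single i 1) * lam i) * (deriv tstar (∑ j, r j * lam j) / p r) := by
      intro i
      ring
    simp only [this]
    rw [← Finset.sum_mul, hscore r]
    field_simp
  have h3 : (∑ i, deriv (deriv tstar) (∑ j, r j * lam j) * lam i * lam i) =
      (∑ i, lam i ^ 2) * deriv (deriv tstar) (∑ j, r j * lam j) := by
    rw [Finset.sum_mul]
    exact Finset.sum_congr rfl fun i _ => by ring
  rw [h2, h3]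
  linear_combination (∑ i, lam i ^ 2) * hode (∑ j, r j * lam j)
end

section
/- Let η > 0 and let P : ℤ → ℝ be a family of nonnegative reals with Σ_{i∈ℤ} P_i = √η/π (so that the piecewise-constant function p(s) = P_i for s ∈ [iπ/√η, (i+1)π/√η) is a probability density on ℝ). Then for all positive integers k and ℓ, ∫_ℝ 2·cos(k√η·s)·cos(ℓ√η·s)·p(s) ds = 1 if k = ℓ and 0 if k ≠ ℓ; that is, the sinusoidal family t_k(s) = √2·cos(k√η·s) is orthonormal for the scalar product ⟨g,h⟩ = ∫ g·h·p. -/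
open MeasureTheory in
theorem aux_cos_int (m n : ℤ) (hm : m ≠ 0) :
    (∫ u in (n:ℝ)..((n:ℝ)+1), Real.cos ((m * Real.pi) * u)) = 0 := by
  have h : (m * Real.pi : ℝ) ≠ 0 := mul_ne_zero (by exact_mod_cast hm) Real.pi_ne_zero
  rw [intervalIntegral.integral_comp_mul_left (fun x => Real.cos x) h, integral_cos]
  have h1 : Real.sin (m * Real.pi * n) = 0 := by
    rw [show (m * Real.pi * n : ℝ) = ((m * n : ℤ) : ℝ) * Real.pi by push_cast; ring]
    exact Real.sin_int_mul_pi _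
  have h2 : Real.sin (m * Real.pi * (n + 1)) = 0 := by
    rw [show (m * Real.pi * (n + 1) : ℝ) = ((m * (n + 1) : ℤ) : ℝ) * Real.pi by push_cast; ring]
    exact Real.sin_int_mul_pi _
  rw [h1, h2]; simp

theorem aux_prod_int (k l : ℕ) (hk : 0 < k) (hl : 0 < l) (n : ℤ) :
    (∫ u in (n:ℝ)..((n:ℝ)+1), 2 * Real.cos (k * Real.pi * u) * Real.cos (l * Real.pi * u))
      = if k = l then 1 else 0 := by
  have e : ∀ u : ℝ, 2 * Real.cos (k * Real.pi * u) * Real.cos (l * Real.pi * u) =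
      Real.cos ((((k:ℤ) - (l:ℤ) : ℤ) * Real.pi) * u)
        + Real.cos ((((k:ℤ) + (l:ℤ) : ℤ) * Real.pi) * u) := by
    intro u
    rw [Real.two_mul_cos_mul_cos]
    push_cast
    congr 2 <;> ring
  simp_rw [e]
  rw [intervalIntegral.integral_add (Continuous.intervalIntegrable (by fun_prop) _ _)
    (Continuous.intervalIntegrable (by fun_prop) _ _),
    aux_cos_int ((k:ℤ) + (l:ℤ)) n (by omega)]
  split_ifs with h
  · subst h; simp
  · rw [aux_cos_int _ n (by omega)]; simp

open MeasureTheory in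
theorem aux_main (P : ℤ → ℝ) (hP : ∀ i, 0 ≤ P i) (hs : Summable P)
    (k l : ℕ) (hk : 0 < k) (hl : 0 < l) :
    (∫ u : ℝ, 2 * Real.cos (k * Real.pi * u) * Real.cos (l * Real.pi * u) * P ⌊u⌋)
      = (∑' i, P i) * (if k = l then 1 else 0) := by
  set F : ℝ → ℝ := fun u => 2 * Real.cos (k * Real.pi * u) * Real.cos (l * Real.pi * u) * P ⌊u⌋
    with hF
  set G : ℤ → ℝ → ℝ := fun i u =>
    2 * Real.cos (k * Real.pi * u) * Real.cos (l * Real.pi * u) * P i with hG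
  have hFG : ∀ i : ℤ, Set.EqOn (F) (G i) (Set.Ico (i:ℝ) (i+1)) := by
    intro i u hu
    have : ⌊u⌋ = i := Int.floor_eq_iff.2 hu
    simp only [hF, hG, this]
  have hGi : ∀ i : ℤ, IntegrableOn (G i) (Set.Ico (i:ℝ) (i+1)) := fun i =>
    ((Continuous.integrableOn_Icc (by fun_prop)).mono_set Set.Ico_subset_Icc_self)
  have hFi : ∀ i : ℤ, IntegrableOn F (Set.Ico (i:ℝ) (i+1)) := fun i =>
    (hGi i).congr_fun (hFG i).symm measurableSet_Ico
  have hU : (⋃ i : ℤ, Set.Ico (i:ℝ) (i+1)) = Set.univ := iUnion_Ico_intCast ℝ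
  have hb : ∀ u, |2 * Real.cos (k * Real.pi * u) * Real.cos (l * Real.pi * u)| ≤ 2 := by
    intro u
    rw [abs_mul, abs_mul, abs_two]
    have h1 := Real.abs_cos_le_one (k * Real.pi * u)
    have h2 := Real.abs_cos_le_one (l * Real.pi * u)
    nlinarith [abs_nonneg (Real.cos (k * Real.pi * u)), abs_nonneg (Real.cos (l * Real.pi * u))]
  have hint : IntegrableOn F (⋃ i : ℤ, Set.Ico (i:ℝ) (i+1)) := by
    apply integrableOn_iUnion_of_summable_integral_norm hFi
    refine Summable.of_nonneg_of_le (fun i => integral_nonneg fun _ => norm_nonneg _) (fun i => ?_)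
      (hs.mul_left 2)
    have := setIntegral_mono_on (hFi i).norm (integrableOn_const (C := 2 * P i) (by simp))
      measurableSet_Ico (fun u hu => by
        rw [hFG i hu, hG, Real.norm_eq_abs, abs_mul, abs_of_nonneg (hP i)]
        exact mul_le_mul_of_nonneg_right (hb u) (hP i))
    simpa using this
  have hS := hasSum_integral_iUnion (fun i => measurableSet_Ico)
    (Set.pairwise_disjoint_Ico_intCast ℝ) hint
  rw [hU, setIntegral_univ] at hS
  rw [← hS.tsum_eq, ← tsum_mul_right]
  congr 1
  ext i
  rw [setIntegral_congr_fun measurableSet_Ico (hFG i), integral_Ico_eq_integral_Ioc,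
    ← intervalIntegral.integral_of_le (by linarith), hG]
  simp only
  rw [intervalIntegral.integral_mul_const, aux_prod_int k l hk hl, mul_comm]

/-- Orthonormality of the sinusoidal family for a flat (piecewise-constant) host density:
with `p(s) = P_i` on `[iπ/√η, (i+1)π/√η)` and `∑ P_i = √η/π`, the functions
`t_k(s) = √2 cos(k√η s)` satisfy `∫ t_k t_ℓ p = δ(k-ℓ)`. -/
theorem sinusoidal_family_orthonormal (η : ℝ) (hη : 0 < η) (P : ℤ → ℝ)
    (hP : ∀ i, 0 ≤ P i) (hsum : (∑' i : ℤ, P i) = Real.sqrt η / Real.pi)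
    (p : ℝ → ℝ) (hp : p = fun s => P ⌊s * Real.sqrt η / Real.pi⌋) :
    ∀ k ℓ : ℕ, 0 < k → 0 < ℓ →
      (∫ s : ℝ, 2 * Real.cos (k * Real.sqrt η * s) * Real.cos (ℓ * Real.sqrt η * s) * p s) =
        if k = ℓ then 1 else 0 := by
  intro k l hk hl
  have hc : 0 < Real.sqrt η / Real.pi := div_pos (Real.sqrt_pos.2 hη) Real.pi_pos
  have hs : Summable P := by
    by_contra h
    rw [tsum_eq_zero_of_not_summable h] at hsum
    linarith
  have key := MeasureTheory.Measure.integral_comp_mul_left (fun u : ℝ =>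
    2 * Real.cos (k * Real.pi * u) * Real.cos (l * Real.pi * u) * P ⌊u⌋) (Real.sqrt η / Real.pi)
  rw [aux_main P hP hs k l hk hl, hsum, abs_of_pos (inv_pos.2 hc), smul_eq_mul, ← mul_assoc,
    inv_mul_cancel₀ hc.ne', one_mul] at key
  rw [← key, hp]
  congr 1
  ext s
  have hpi := Real.pi_ne_zero
  have e : ∀ m : ℝ, m * Real.pi * (Real.sqrt η / Real.pi * s) = m * Real.sqrt η * s := by
    intro m; field_simp
  beta_reduce
  rw [e, e, show s * Real.sqrt η / Real.pi = Real.sqrt η / Real.pi * s by ring]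
end
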